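/- Let p ≥ 1, k ≥ 1, and let α_1, ..., α_{k+1} and γ_1, ..., γ_k be complex numbers with Re(α_j + γ_j) > p-1 for j = 1, ..., k, Re(α_j) > p-1 for j = 1, ..., k+1. Let f₁ be the complex matrix-variate type-1 Dirichlet density f₁(X_1,...,X_k) = D̃_k ∏_{j=1}^k det(X_j)^{α_j - p} · det(I - X_1 - ... - X_k)^{α_{k+1} - p}, with D̃_k = Γ̃_p(α_1 + ... + α_{k+1}) / ∏_{j=1}^{k+1} Γ̃_p(α_j), supported on tuples of positive definite p×p self-adjoint matrices with I - X_1 - ... - X_k positive definite. Then the Dirichlet average of φ₁(X_1,...,X_k) = ∏_{j=1}^k det(X_j)^{γ_j}, i.e., the integral of φ₁ against f₁ with respect to μ_p^{⊗k}, equals ( ∏_{j=1}^k Γ̃_p(α_j + γ_j)/Γ̃_p(α_j) ) · Γ̃_p(α_1 + ... + α_{k+1}) / Γ̃_p(α_1 + γ_1 + ... + α_k + γ_k + α_{k+1}). -/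

import Mathlib

open MeasureTheory Matrix
open scoped ComplexOrder

noncomputable section

/-- Parameter space `ℝ^p × ℂ^{p(p-1)/2}` for `p × p` Hermitian matrices:
the real diagonal entries together with the strictly upper-triangular complex entries. -/
abbrev HermParam (p : ℕ) : Type :=
  (Fin p → ℝ) × ({ q : Fin p × Fin p // q.1 < q.2 } → ℂ)

/-- The linear isomorphism sending the parameters to the corresponding self-adjoint matrix. -/
def toHermMatrix (p : ℕ) (T : HermParam p) : Matrix (Fin p) (Fin p) ℂ :=
  Matrix.of fun i j =>
    if h : i < j then T.2 ⟨(i, j), h⟩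
    else if h' : j < i then (starRingEnd ℂ) (T.2 ⟨(j, i), h'⟩)
    else (T.1 i : ℂ)

noncomputable instance matrixComplexMeasureSpace (m n : ℕ) :
    MeasureSpace (Matrix (Fin m) (Fin n) ℂ) :=
  inferInstanceAs (MeasureSpace (Fin m → Fin n → ℂ))

/-- The Lebesgue measure `μ_p` on Herm(p), realized as a measure on the space of
`p × p` complex matrices: the pushforward of Lebesgue measure on the parameter space
under the linear isomorphism `toHermMatrix p`. -/
def hermLebesgue (p : ℕ) : Measure (Matrix (Fin p) (Fin p) ℂ) :=
  Measure.map (toHermMatrix p) volume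

/-- The complex matrix-variate gamma function
`Γ̃_p(α) = π^{p(p-1)/2} ∏_{j=1}^p Γ(α - j + 1) = π^{p(p-1)/2} ∏_{j=0}^{p-1} Γ(α - j)`. -/
def cGammaP (p : ℕ) (α : ℂ) : ℂ :=
  (Real.pi : ℂ) ^ (p * (p - 1) / 2) * ∏ j : Fin p, Complex.Gamma (α - j)

end

theorem toHermMatrix_apply_self {p : ℕ} (T : HermParam p) (i : Fin p) :
    toHermMatrix p T i i = (T.1 i : ℂ) := by
  simp [toHermMatrix]

theorem toHermMatrix_apply_of_lt {p : ℕ} (T : HermParam p) {i j : Fin p} (h : i < j) :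
    toHermMatrix p T i j = T.2 ⟨(i, j), h⟩ := by
  simp [toHermMatrix, h]

theorem toHermMatrix_apply_of_gt {p : ℕ} (T : HermParam p) {i j : Fin p} (h : j < i) :
    toHermMatrix p T i j = (starRingEnd ℂ) (T.2 ⟨(j, i), h⟩) := by
  simp [toHermMatrix, h, h.not_gt]

theorem isHermitian_toHermMatrix {p : ℕ} (T : HermParam p) : (toHermMatrix p T).IsHermitian := by
  ext i j
  rw [conjTranspose_apply]
  rcases lt_trichotomy i j with h | rfl | h
  · rw [toHermMatrix_apply_of_lt T h, toHermMatrix_apply_of_gt T h]; simp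
  · simp [toHermMatrix_apply_self]
  · rw [toHermMatrix_apply_of_lt T h, toHermMatrix_apply_of_gt T h]; simp

/-- `toHermMatrix` as a real-linear map. -/
noncomputable def toHermLin (p : ℕ) : HermParam p →ₗ[ℝ] Matrix (Fin p) (Fin p) ℂ where
  toFun := toHermMatrix p
  map_add' S T := by
    ext i j
    rw [Matrix.add_apply]
    rcases lt_trichotomy i j with h | rfl | h
    · simp [toHermMatrix_apply_of_lt _ h]
    · simp [toHermMatrix_apply_self]
    · simp [toHermMatrix_apply_of_gt _ h]
  map_smul' c T := by
    ext i j
    rw [Matrix.smul_apply]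
    rcases lt_trichotomy i j with h | rfl | h
    · simp [toHermMatrix_apply_of_lt _ h]
    · simp [toHermMatrix_apply_self]
    · simp [toHermMatrix_apply_of_gt _ h]

theorem toHermLin_apply {p : ℕ} (T : HermParam p) : toHermLin p T = toHermMatrix p T := rfl

/-- The real diagonal and the strictly upper triangular entries of a complex matrix. -/
noncomputable def hermCoords (p : ℕ) : Matrix (Fin p) (Fin p) ℂ →ₗ[ℝ] HermParam p where
  toFun M := (fun i => (M i i).re, fun q => M q.1.1 q.1.2)
  map_add' M N := by ext <;> simp
  map_smul' c M := by ext <;> simp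

theorem hermCoords_toHermMatrix {p : ℕ} (T : HermParam p) :
    hermCoords p (toHermMatrix p T) = T := by
  refine Prod.ext ?_ ?_
  · funext i
    simp [hermCoords, toHermMatrix_apply_self]
  · funext ⟨q, hq⟩
    simp [hermCoords, toHermMatrix_apply_of_lt T hq]

theorem toHermMatrix_hermCoords {p : ℕ} {M : Matrix (Fin p) (Fin p) ℂ} (hM : M.IsHermitian) :
    toHermMatrix p (hermCoords p M) = M := by
  ext i j
  rcases lt_trichotomy i j with h | rfl | h
  · simp [toHermMatrix_apply_of_lt _ h, hermCoords]
  · have := hM.apply i i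
    simp only [toHermMatrix_apply_self, hermCoords, LinearMap.coe_mk, AddHom.coe_mk]
    exact Complex.conj_eq_iff_re.mp this
  · simpa [toHermMatrix_apply_of_gt _ h, hermCoords] using hM.apply i j

/-- Conjugation `X ↦ A X Aᴴ` on all complex matrices, as a real-linear map. -/
noncomputable def conjLin {p : ℕ} (A : Matrix (Fin p) (Fin p) ℂ) :
    Matrix (Fin p) (Fin p) ℂ →ₗ[ℝ] Matrix (Fin p) (Fin p) ℂ :=
  (LinearMap.mulLeft ℝ A).comp (LinearMap.mulRight ℝ Aᴴ)

theorem conjLin_apply {p : ℕ} (A X : Matrix (Fin p) (Fin p) ℂ) :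
    conjLin A X = A * (X * Aᴴ) := rfl

theorem det_mulRight_matrix {p : ℕ} (B : Matrix (Fin p) (Fin p) ℂ) :
    LinearMap.det (LinearMap.mulRight ℂ B) = B.det ^ p := by
  have h : LinearMap.mulRight ℂ B =
      (LinearMap.pi fun i : Fin p => (Matrix.vecMulLinear B).comp (LinearMap.proj i)
        : (Fin p → Fin p → ℂ) →ₗ[ℂ] (Fin p → Fin p → ℂ)) := by
    refine LinearMap.ext fun X => ?_
    ext i j
    rfl
  have h2 : LinearMap.det (Matrix.vecMulLinear B) = B.det := by
    have : Matrix.vecMulLinear B = Matrix.toLin' Bᵀ := by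
      refine LinearMap.ext fun x => ?_
      simp [Matrix.mulVec_transpose]
    rw [this, LinearMap.det_toLin', Matrix.det_transpose]
  rw [h]
  erw [LinearMap.det_pi]
  rw [h2]
  simp

theorem det_conjLin {p : ℕ} (A : Matrix (Fin p) (Fin p) ℂ) :
    LinearMap.det (conjLin A) = (Complex.normSq A.det ^ p) ^ 2 := by
  have hR : LinearMap.det (LinearMap.mulRight ℝ Aᴴ) = Complex.normSq A.det ^ p := by
    have : LinearMap.mulRight ℝ Aᴴ = (LinearMap.mulRight ℂ Aᴴ).restrictScalars ℝ := rfl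
    rw [this, LinearMap.det_restrictScalars, det_mulRight_matrix, Algebra.norm_complex_apply,
      map_pow, Matrix.det_conjTranspose]
    congr 1
    exact Complex.normSq_conj _
  have hL : LinearMap.det (LinearMap.mulLeft ℝ A) = Complex.normSq A.det ^ p := by
    let σ : Matrix (Fin p) (Fin p) ℂ ≃ₗ[ℝ] Matrix (Fin p) (Fin p) ℂ :=
      Matrix.conjTransposeLinearEquiv _ _ ℝ ℂ
    have : LinearMap.mulLeft ℝ A = (σ : _ →ₗ[ℝ] _) ∘ₗ LinearMap.mulRight ℝ Aᴴ ∘ₗ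
        (σ.symm : _ →ₗ[ℝ] _) := by
      refine LinearMap.ext fun X => ?_
      simp [σ, Matrix.conjTransposeLinearEquiv]
    rw [this, LinearMap.det_conj, hR]
  rw [conjLin, LinearMap.det_comp, hR, hL, sq]

/-- Conjugation `X ↦ A X Aᴴ` in the coordinates of Hermitian matrices. -/
noncomputable def hermConj {p : ℕ} (A : Matrix (Fin p) (Fin p) ℂ) : HermParam p →ₗ[ℝ] HermParam p :=
  (hermCoords p).comp ((conjLin A).comp (toHermLin p))

theorem toHermMatrix_hermConj {p : ℕ} (A : Matrix (Fin p) (Fin p) ℂ) (T : HermParam p) :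
    toHermMatrix p (hermConj A T) = A * toHermMatrix p T * Aᴴ := by
  have : (conjLin A (toHermMatrix p T)).IsHermitian := by
    rw [conjLin_apply, ← Matrix.mul_assoc]
    exact Matrix.isHermitian_mul_mul_conjTranspose A (isHermitian_toHermMatrix T)
  rw [hermConj, LinearMap.comp_apply, LinearMap.comp_apply, toHermLin_apply,
    toHermMatrix_hermCoords this, conjLin_apply, Matrix.mul_assoc]

/-- Every complex matrix is uniquely `X + iY` with `X`, `Y` Hermitian. -/
noncomputable def cartesianEquiv (p : ℕ) :
    (HermParam p × HermParam p) ≃ₗ[ℝ] Matrix (Fin p) (Fin p) ℂ :=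
  LinearEquiv.ofBijective
    ((toHermLin p).coprod (LinearMap.comp (LinearMap.mulLeft ℝ (Complex.I • 1)) (toHermLin p)))
    (by
      have key : ∀ X Y : HermParam p, ((toHermLin p).coprod
          (LinearMap.comp (LinearMap.mulLeft ℝ (Complex.I • 1)) (toHermLin p))) (X, Y) =
          toHermMatrix p X + Complex.I • toHermMatrix p Y := fun X Y => by
        simp [toHermLin_apply]
      constructor
      · rw [← LinearMap.ker_eq_bot, LinearMap.ker_eq_bot']
        rintro ⟨X, Y⟩ h
        rw [key] at h
        have h' := congrArg Matrix.conjTranspose h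
        rw [conjTranspose_add, conjTranspose_smul, (isHermitian_toHermMatrix X).eq,
          (isHermitian_toHermMatrix Y).eq] at h'
        simp only [RCLike.star_def, Complex.conj_I, neg_smul, conjTranspose_zero] at h'
        have hX : toHermMatrix p X = 0 := by
          have : (2 : ℂ) • toHermMatrix p X = 0 := by
            rw [two_smul]
            calc _ = (toHermMatrix p X + Complex.I • toHermMatrix p Y) +
                (toHermMatrix p X + -(Complex.I • toHermMatrix p Y)) := by abel
              _ = 0 := by rw [h, h', add_zero]
          simpa using this
        have hY : toHermMatrix p Y = 0 := by
          rw [hX, zero_add] at h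
          simpa using h
        have hX' := hermCoords_toHermMatrix X
        have hY' := hermCoords_toHermMatrix Y
        rw [hX, map_zero] at hX'
        rw [hY, map_zero] at hY'
        rw [← hX', ← hY']; rfl
      · intro M
        have h1 : ((1 / 2 : ℂ) • (M + Mᴴ)).IsHermitian := by
          rw [Matrix.IsHermitian, conjTranspose_smul, conjTranspose_add, conjTranspose_conjTranspose,
            add_comm]
          simp
        have h2 : ((-Complex.I / 2 : ℂ) • (M - Mᴴ)).IsHermitian := by
          rw [Matrix.IsHermitian, conjTranspose_smul, conjTranspose_sub, conjTranspose_conjTranspose,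
            ← neg_sub M, smul_neg, ← neg_smul]
          simp [neg_div]
        refine ⟨(hermCoords p ((1 / 2 : ℂ) • (M + Mᴴ)),
          hermCoords p ((-Complex.I / 2 : ℂ) • (M - Mᴴ))), ?_⟩
        rw [key, toHermMatrix_hermCoords h1, toHermMatrix_hermCoords h2, smul_smul]
        have : Complex.I * (-Complex.I / 2) = 1 / 2 := by
          linear_combination (-1 / 2 : ℂ) * Complex.I_sq
        rw [this, ← smul_add]
        have : M + Mᴴ + (M - Mᴴ) = (2 : ℂ) • M := by rw [two_smul]; abel
        rw [this, smul_smul]; simp)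

theorem cartesianEquiv_apply {p : ℕ} (X Y : HermParam p) :
    cartesianEquiv p (X, Y) = toHermMatrix p X + Complex.I • toHermMatrix p Y := by
  change ((toHermLin p).coprod
    (LinearMap.comp (LinearMap.mulLeft ℝ (Complex.I • 1)) (toHermLin p))) (X, Y) = _
  simp [toHermLin_apply]

theorem abs_det_hermConj {p : ℕ} (A : Matrix (Fin p) (Fin p) ℂ) :
    |LinearMap.det (hermConj A)| = Complex.normSq A.det ^ p := by
  have h : conjLin A = (cartesianEquiv p : _ →ₗ[ℝ] _) ∘ₗ (hermConj A).prodMap (hermConj A) ∘ₗ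
      ((cartesianEquiv p).symm : _ →ₗ[ℝ] _) := by
    refine LinearMap.ext fun M => ?_
    obtain ⟨⟨X, Y⟩, rfl⟩ := (cartesianEquiv p).surjective M
    rw [LinearMap.comp_apply, LinearMap.comp_apply, LinearEquiv.coe_coe, LinearEquiv.coe_coe,
      LinearEquiv.symm_apply_apply, LinearMap.prodMap_apply, cartesianEquiv_apply,
      cartesianEquiv_apply, toHermMatrix_hermConj, toHermMatrix_hermConj, conjLin_apply]
    simp [Matrix.mul_add, Matrix.add_mul, Matrix.mul_assoc]
  have h2 := det_conjLin A
  rw [h, LinearMap.det_conj, LinearMap.det_prodMap, ← sq] at h2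
  rw [← sq_eq_sq₀ (abs_nonneg _) (pow_nonneg (Complex.normSq_nonneg _) _), sq_abs, h2]

instance isAddHaarMeasure_hermParam (p : ℕ) :
    (volume : Measure (HermParam p)).IsAddHaarMeasure :=
  Measure.prod.instIsAddHaarMeasure _ _

instance borelSpace_hermParam (p : ℕ) :
    @BorelSpace (HermParam p) PseudoMetricSpace.toUniformSpace.toTopologicalSpace _ :=
  (inferInstance : BorelSpace (HermParam p))

instance isAddHaarMeasure_pi_hermParam (p k : ℕ) :
    (volume : Measure (Fin k → HermParam p)).IsAddHaarMeasure :=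
  Measure.pi.isAddHaarMeasure _

instance borelSpace_pi_hermParam (p k : ℕ) :
    @BorelSpace (Fin k → HermParam p) PseudoMetricSpace.toUniformSpace.toTopologicalSpace _ :=
  (inferInstance : BorelSpace (Fin k → HermParam p))

open scoped MatrixOrder in
theorem exists_eq_mul_conjTranspose_of_posSemidef {p : ℕ} {M : Matrix (Fin p) (Fin p) ℂ}
    (hM : M.PosSemidef) : ∃ A : Matrix (Fin p) (Fin p) ℂ, M = A * Aᴴ := by
  refine ⟨CFC.sqrt M, ?_⟩
  rw [(CFC.sqrt_nonneg M).posSemidef.1.eq, CFC.sqrt_mul_sqrt_self M hM.nonneg]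

theorem continuous_toHermMatrix (p : ℕ) : Continuous (toHermMatrix p) :=
  (toHermLin p).continuous_of_finiteDimensional

theorem measurableSet_posDef_toHermMatrix (p : ℕ) :
    MeasurableSet {T : HermParam p | (toHermMatrix p T).PosDef} := by
  have h : {T : HermParam p | (toHermMatrix p T).PosDef} =
      (⋂ x : Fin p → ℂ, {T | 0 ≤ star x ⬝ᵥ (toHermMatrix p T *ᵥ x)}) ∩
        {T | (toHermMatrix p T).det ≠ 0} := by
    ext T
    simp only [Set.mem_ofPred_eq, Set.mem_inter_iff, Set.mem_iInter]
    constructor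
    · exact fun h => ⟨fun x => h.posSemidef.dotProduct_mulVec_nonneg x, h.det_pos.ne'⟩
    · rintro ⟨h1, h2⟩
      exact (PosSemidef.of_dotProduct_mulVec_nonneg
        (isHermitian_toHermMatrix T) h1).posDef_iff_det_ne_zero.mpr h2
  rw [h]
  refine MeasurableSet.inter (IsClosed.measurableSet ?_) (IsOpen.measurableSet ?_)
  · refine isClosed_iInter fun x => isClosed_le continuous_const ?_
    exact continuous_const.dotProduct ((continuous_toHermMatrix p).matrix_mulVec continuous_const)
  · exact isOpen_ne_fun (continuous_toHermMatrix p).matrix_det continuous_const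

/-- The power `det(X)^(a - p)` on the cone of positive definite matrices, extended by zero. -/
noncomputable def conePow (p : ℕ) (a : ℂ) : HermParam p → ℂ :=
  Set.indicator {T | (toHermMatrix p T).PosDef}
    fun T => ((toHermMatrix p T).det.re : ℂ) ^ (a - p)

theorem conePow_of_posDef {p : ℕ} (a : ℂ) {T : HermParam p} (hT : (toHermMatrix p T).PosDef) :
    conePow p a T = ((toHermMatrix p T).det.re : ℂ) ^ (a - p) :=
  Set.indicator_of_mem (s := {T | (toHermMatrix p T).PosDef}) hT _

theorem conePow_of_not_posDef {p : ℕ} (a : ℂ) {T : HermParam p}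
    (hT : ¬ (toHermMatrix p T).PosDef) : conePow p a T = 0 :=
  Set.indicator_of_notMem (s := {T | (toHermMatrix p T).PosDef}) hT _

theorem posDef_toHermMatrix_hermConj {p : ℕ} {A : Matrix (Fin p) (Fin p) ℂ} (hA : A.det ≠ 0)
    (T : HermParam p) :
    (toHermMatrix p (hermConj A T)).PosDef ↔ (toHermMatrix p T).PosDef := by
  have hU : IsUnit A := (Matrix.isUnit_iff_isUnit_det A).2 hA.isUnit
  rw [toHermMatrix_hermConj, ← Matrix.star_eq_conjTranspose, hU.posDef_star_right_conjugate_iff]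

theorem det_mul_mul_conjTranspose {p : ℕ} (A M : Matrix (Fin p) (Fin p) ℂ) :
    (A * M * Aᴴ).det = (Complex.normSq A.det : ℂ) * M.det := by
  rw [det_mul, det_mul, det_conjTranspose, ← Complex.mul_conj]
  simp only [RCLike.star_def]
  ring

theorem conePow_hermConj {p : ℕ} (a : ℂ) {A : Matrix (Fin p) (Fin p) ℂ} (hA : A.det ≠ 0)
    (T : HermParam p) :
    conePow p a (hermConj A T) = (Complex.normSq A.det : ℂ) ^ (a - p) * conePow p a T := by
  by_cases hT : (toHermMatrix p T).PosDef
  · rw [conePow_of_posDef a hT, conePow_of_posDef a ((posDef_toHermMatrix_hermConj hA T).2 hT),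
      toHermMatrix_hermConj, det_mul_mul_conjTranspose, Complex.re_ofReal_mul, Complex.ofReal_mul,
      Complex.mul_cpow_ofReal_nonneg (Complex.normSq_nonneg _)
        (Complex.pos_iff.1 hT.det_pos).1.le]
  · rw [conePow_of_not_posDef a hT, mul_zero, conePow_of_not_posDef]
    rwa [posDef_toHermMatrix_hermConj hA]

theorem integral_comp_hermConj_pi {p k : ℕ} {A : Matrix (Fin p) (Fin p) ℂ} (hA : A.det ≠ 0)
    (f : (Fin k → HermParam p) → ℂ) :
    ∫ X : Fin k → HermParam p, f X = (Complex.normSq A.det : ℂ) ^ (p * k) *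
      ∫ X : Fin k → HermParam p, f (fun j => hermConj A (X j)) := by
  have hc : 0 < Complex.normSq A.det := Complex.normSq_pos.2 hA
  set L : (Fin k → HermParam p) →ₗ[ℝ] (Fin k → HermParam p) :=
    LinearMap.pi fun j => (hermConj A).comp (LinearMap.proj j) with hL
  have hdet : |LinearMap.det L| = Complex.normSq A.det ^ (p * k) := by
    rw [hL, LinearMap.det_pi, Finset.prod_const, abs_pow, abs_det_hermConj, Finset.card_univ,
      Fintype.card_fin, pow_mul]
  have hL0 : LinearMap.det L ≠ 0 := by
    rw [← abs_ne_zero, hdet]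
    positivity
  have hmap := Measure.map_linearMap_addHaar_eq_smul_addHaar
    (volume : Measure (Fin k → HermParam p)) hL0
  have hemb : MeasurableEmbedding L :=
    ((LinearEquiv.ofIsUnitDet (f := L) (v := Module.finBasis ℝ _) (v' := Module.finBasis ℝ _)
      (by rw [LinearMap.det_toMatrix]; exact hL0.isUnit)).toContinuousLinearEquiv.toHomeomorph
      ).measurableEmbedding
  have h1 := hemb.integral_map (μ := volume) f
  rw [hmap, integral_smul_measure, abs_inv, hdet,
    ENNReal.toReal_ofReal (inv_nonneg.2 (pow_nonneg hc.le _))] at h1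
  have h2 : ∫ X : Fin k → HermParam p, f (fun j => hermConj A (X j)) =
    ∫ X : Fin k → HermParam p, f (L X) := rfl
  rw [h2, ← h1, Complex.real_smul, ← mul_assoc]
  push_cast
  rw [mul_inv_cancel₀, one_mul]
  exact pow_ne_zero _ (Complex.ofReal_ne_zero.2 (ne_of_gt hc))

/-- The unnormalised Dirichlet integral over the set `X₁ + ⋯ + X_k < S`. -/
noncomputable def dirichletIntegral (p : ℕ) {k : ℕ} (a : Fin k → ℂ) (b : ℂ) (S : HermParam p) : ℂ :=
  ∫ X : Fin k → HermParam p, (∏ j, conePow p (a j) (X j)) * conePow p b (S - ∑ j, X j)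

theorem dirichletIntegral_hermConj {p k : ℕ} (a : Fin k → ℂ) (b : ℂ)
    {A : Matrix (Fin p) (Fin p) ℂ} (hA : A.det ≠ 0) (S : HermParam p) :
    dirichletIntegral p a b (hermConj A S) =
      (Complex.normSq A.det : ℂ) ^ ((∑ j, a j) + b - p) * dirichletIntegral p a b S := by
  have hc : (Complex.normSq A.det : ℂ) ≠ 0 := Complex.ofReal_ne_zero.2 (Complex.normSq_pos.2 hA).ne'
  rw [dirichletIntegral, integral_comp_hermConj_pi hA]
  have : ∀ X : Fin k → HermParam p,
      (∏ j, conePow p (a j) (hermConj A (X j))) *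
          conePow p b (hermConj A S - ∑ j, hermConj A (X j)) =
        (Complex.normSq A.det : ℂ) ^ ((∑ j, (a j - p)) + (b - p)) *
          ((∏ j, conePow p (a j) (X j)) * conePow p b (S - ∑ j, X j)) := fun X => by
    rw [← map_sum, ← map_sub, conePow_hermConj b hA, Complex.cpow_add _ _ hc]
    simp only [conePow_hermConj _ hA, Finset.prod_mul_distrib]
    have : ∏ j, (Complex.normSq A.det : ℂ) ^ (a j - p) =
        (Complex.normSq A.det : ℂ) ^ (∑ j, (a j - p)) := by
      induction (Finset.univ : Finset (Fin k)) using Finset.induction_on with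
      | empty => simp
      | insert i s hi ih =>
        rw [Finset.prod_insert hi, Finset.sum_insert hi, Complex.cpow_add _ _ hc, ih]
    rw [this]
    ring
  simp only [this]
  rw [integral_const_mul, ← mul_assoc, ← Complex.cpow_natCast, ← Complex.cpow_add _ _ hc,
    dirichletIntegral]
  congr 2
  simp
  ring

theorem dirichletIntegral_eq {p k : ℕ} (a : Fin k → ℂ) (b : ℂ) (S : HermParam p) :
    dirichletIntegral p a b S =
      conePow p ((∑ j, a j) + b) S * dirichletIntegral p a b (hermCoords p 1) := by
  by_cases hS : (toHermMatrix p S).PosDef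
  · obtain ⟨A, hA⟩ := exists_eq_mul_conjTranspose_of_posSemidef hS.posSemidef
    have hdet : (toHermMatrix p S).det = (Complex.normSq A.det : ℂ) := by
      have := det_mul_mul_conjTranspose A 1
      rwa [mul_one, ← hA, det_one, mul_one] at this
    have hA0 : A.det ≠ 0 := by
      intro h
      have := hS.det_pos.ne'
      rw [hdet, h] at this
      simp at this
    have hS' : S = hermConj A (hermCoords p 1) := by
      rw [← hermCoords_toHermMatrix (hermConj A (hermCoords p 1)), toHermMatrix_hermConj,
        toHermMatrix_hermCoords isHermitian_one, mul_one, ← hA, hermCoords_toHermMatrix]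
    rw [conePow_of_posDef _ hS, hdet, Complex.ofReal_re]
    conv_lhs => rw [hS', dirichletIntegral_hermConj a b hA0]
  · rw [conePow_of_not_posDef _ hS, zero_mul, dirichletIntegral]
    refine integral_eq_zero_of_ae (Filter.Eventually.of_forall fun X => ?_)
    by_contra hne
    have h1 := left_ne_zero_of_mul hne
    have h2 := right_ne_zero_of_mul hne
    have hX : ∀ j, (toHermMatrix p (X j)).PosDef := fun j => by
      by_contra h
      exact Finset.prod_ne_zero_iff.1 h1 j (Finset.mem_univ j) (conePow_of_not_posDef _ h)
    have hY : (toHermMatrix p (S - ∑ j, X j)).PosDef := by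
      by_contra h
      exact h2 (conePow_of_not_posDef _ h)
    apply hS
    have : toHermMatrix p S = toHermMatrix p (S - ∑ j, X j) + ∑ j, toHermMatrix p (X j) := by
      simp only [← toHermLin_apply, map_sub, map_sum]
      abel
    rw [this]
    exact hY.add_posSemidef (posSemidef_sum _ fun j _ => (hX j).posSemidef)

/-- The exponential `exp(-tr X)`. -/
noncomputable def expNegTrace (p : ℕ) (T : HermParam p) : ℂ :=
  Complex.exp (-((∑ i, T.1 i : ℝ) : ℂ))

theorem expNegTrace_add {p : ℕ} (S T : HermParam p) :
    expNegTrace p (S + T) = expNegTrace p S * expNegTrace p T := by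
  rw [expNegTrace, expNegTrace, expNegTrace, ← Complex.exp_add]
  congr 1
  simp [Finset.sum_add_distrib]
  ring

theorem expNegTrace_sum {p k : ℕ} (X : Fin k → HermParam p) :
    expNegTrace p (∑ j, X j) = ∏ j, expNegTrace p (X j) := by
  induction (Finset.univ : Finset (Fin k)) using Finset.induction_on with
  | empty => simp [expNegTrace]
  | insert i s hi ih => rw [Finset.prod_insert hi, Finset.sum_insert hi, expNegTrace_add, ih]

theorem measurable_hermCoords (p : ℕ) : Measurable (hermCoords p) := by
  refine Measurable.prodMk ?_ ?_
  · refine measurable_pi_lambda _ fun i => Complex.measurable_re.comp ?_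
    exact (measurable_pi_apply i).comp (measurable_pi_apply i)
  · refine measurable_pi_lambda _ fun q => ?_
    exact (measurable_pi_apply q.1.2).comp (measurable_pi_apply q.1.1)

/-- Splitting off the first row of a strictly upper-triangular array. -/
noncomputable def upperTriangleSuccEquiv (p : ℕ) :
    Fin p ⊕ { q : Fin p × Fin p // q.1 < q.2 } ≃
      { q : Fin (p + 1) × Fin (p + 1) // q.1 < q.2 } :=
  Equiv.ofBijective
    (Sum.elim (fun i => ⟨(0, i.succ), Fin.succ_pos i⟩)
      fun q => ⟨(q.1.1.succ, q.1.2.succ), Fin.succ_lt_succ_iff.2 q.2⟩) <| by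
    constructor
    · rintro (i | ⟨⟨i, j⟩, hij⟩) (i' | ⟨⟨i', j'⟩, hij'⟩) h
      · simpa using h
      · exact absurd (congrArg (fun x => x.1.1) h) (Fin.succ_ne_zero i').symm
      · exact absurd (congrArg (fun x => x.1.1) h) (Fin.succ_ne_zero i)
      · simpa using h
    · rintro ⟨⟨i, j⟩, hij⟩
      have hj : j ≠ 0 := (lt_of_le_of_lt (Fin.zero_le i) hij).ne'
      obtain ⟨j, rfl⟩ := Fin.exists_succ_eq.2 hj
      rcases Fin.eq_zero_or_eq_succ i with rfl | ⟨i, rfl⟩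
      · exact ⟨Sum.inl j, rfl⟩
      · exact ⟨Sum.inr ⟨(i, j), Fin.succ_lt_succ_iff.1 hij⟩, rfl⟩

/-- The corner entry, the first row and the remaining block of a Hermitian matrix. -/
noncomputable def hermSplit (p : ℕ) (T : HermParam (p + 1)) : (ℝ × (Fin p → ℂ)) × HermParam p :=
  ((T.1 0, fun i => T.2 (upperTriangleSuccEquiv p (Sum.inl i))),
    (fun i => T.1 i.succ, fun q => T.2 (upperTriangleSuccEquiv p (Sum.inr q))))

theorem measurePreserving_prod_prod_prod_comm {A B C D : Type*} [MeasureSpace A] [MeasureSpace B]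
    [MeasureSpace C] [MeasureSpace D] [SigmaFinite (volume : Measure A)]
    [SigmaFinite (volume : Measure B)] [SigmaFinite (volume : Measure C)]
    [SigmaFinite (volume : Measure D)] :
    MeasurePreserving (fun q : (A × B) × (C × D) => ((q.1.1, q.2.1), (q.1.2, q.2.2))) := by
  have h1 : MeasurePreserving (MeasurableEquiv.prodAssoc : (A × B) × (C × D) ≃ᵐ _) :=
    volume_preserving_prodAssoc
  have h2 : MeasurePreserving (MeasurableEquiv.prodAssoc : (B × C) × D ≃ᵐ _) :=
    volume_preserving_prodAssoc
  have h3 : MeasurePreserving (MeasurableEquiv.prodAssoc : (C × B) × D ≃ᵐ _) :=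
    volume_preserving_prodAssoc
  have h4 : MeasurePreserving (MeasurableEquiv.prodAssoc : (A × C) × (B × D) ≃ᵐ _) :=
    volume_preserving_prodAssoc
  have h5 : MeasurePreserving (Prod.swap : B × C → C × B) := Measure.measurePreserving_swap
  have h6 := (MeasurePreserving.id (volume : Measure A)).prod
    ((h3.comp (h5.prod (MeasurePreserving.id (volume : Measure D)))).comp (h2.symm _))
  exact ((h4.symm _).comp h6).comp h1

theorem measurePreserving_hermSplit (p : ℕ) : MeasurePreserving (hermSplit p) := by
  have h1 : MeasurePreserving (MeasurableEquiv.piFinSuccAbove (fun _ : Fin (p + 1) => ℝ) 0) :=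
    volume_preserving_piFinSuccAbove _ 0
  have h2 := (volume_measurePreserving_piCongrLeft
    (fun _ : { q : Fin (p + 1) × Fin (p + 1) // q.1 < q.2 } => ℂ)
    (upperTriangleSuccEquiv p)).symm _
  have h3 := volume_measurePreserving_sumPiEquivProdPi
    (fun _ : Fin p ⊕ { q : Fin p × Fin p // q.1 < q.2 } => ℂ)
  exact measurePreserving_prod_prod_prod_comm.comp (h1.prod (h3.comp h2))

/-- The parameters of the Schur complement of the corner entry `x`, for a Hermitian matrix with
first row `(x, z)`. -/
noncomputable def schurShift {p : ℕ} (u : ℝ × (Fin p → ℂ)) : HermParam p :=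
  hermCoords p (((u.1⁻¹ : ℝ) : ℂ) • vecMulVec (star u.2) u.2)

theorem schurShift_fst {p : ℕ} (u : ℝ × (Fin p → ℂ)) (i : Fin p) :
    (schurShift u).1 i = u.1⁻¹ * Complex.normSq (u.2 i) := by
  change ((((u.1⁻¹ : ℝ) : ℂ) • vecMulVec (star u.2) u.2) i i).re = _
  rw [Matrix.smul_apply, vecMulVec_apply, smul_eq_mul, Complex.re_ofReal_mul, Pi.star_apply,
    Complex.star_def, mul_comm (starRingEnd ℂ _), Complex.mul_conj, Complex.ofReal_re]

theorem toHermMatrix_sub_schurShift {p : ℕ} (Y : HermParam p) (u : ℝ × (Fin p → ℂ)) :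
    toHermMatrix p (Y - schurShift u) =
      toHermMatrix p Y - ((u.1⁻¹ : ℝ) : ℂ) • vecMulVec (star u.2) u.2 := by
  rw [← toHermLin_apply, map_sub, toHermLin_apply, toHermLin_apply, schurShift,
    toHermMatrix_hermCoords]
  ext i j
  simp [conjTranspose_apply, vecMulVec_apply, mul_comm]

/-- The equivalence between `Unit ⊕ Fin p` and `Fin (p + 1)` sending the left summand to `0`. -/
def unitSumFinEquiv (p : ℕ) : Unit ⊕ Fin p ≃ Fin (p + 1) where
  toFun := Sum.elim (fun _ => 0) Fin.succ
  invFun := Fin.cases (Sum.inl ()) Sum.inr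
  left_inv := by rintro (_ | i) <;> rfl
  right_inv i := by refine Fin.cases ?_ (fun i => ?_) i <;> rfl

theorem toHermMatrix_submatrix {p : ℕ} (T : HermParam (p + 1)) :
    (toHermMatrix (p + 1) T).submatrix (unitSumFinEquiv p) (unitSumFinEquiv p) =
      fromBlocks (diagonal fun _ : Unit => ((hermSplit p T).1.1 : ℂ))
        (replicateRow Unit (hermSplit p T).1.2) (replicateRow Unit (hermSplit p T).1.2)ᴴ
        (toHermMatrix p (hermSplit p T).2) := by
  ext (i | i) (j | j)
  · exact (toHermMatrix_apply_self T 0).trans (by simp [hermSplit])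
  · exact toHermMatrix_apply_of_lt T (Fin.succ_pos j)
  · exact toHermMatrix_apply_of_gt T (Fin.succ_pos i)
  · rw [submatrix_apply, fromBlocks_apply₂₂]
    change toHermMatrix (p + 1) T i.succ j.succ = _
    rcases lt_trichotomy i j with h | rfl | h
    · rw [toHermMatrix_apply_of_lt _ h, toHermMatrix_apply_of_lt _ (Fin.succ_lt_succ_iff.2 h)]
      rfl
    · rw [toHermMatrix_apply_self, toHermMatrix_apply_self]
      rfl
    · rw [toHermMatrix_apply_of_gt _ h, toHermMatrix_apply_of_gt _ (Fin.succ_lt_succ_iff.2 h)]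
      rfl

theorem schurComplement_eq {p : ℕ} (T : HermParam (p + 1)) :
    toHermMatrix p (hermSplit p T).2 - (replicateRow Unit (hermSplit p T).1.2)ᴴ *
      (diagonal fun _ : Unit => ((hermSplit p T).1.1 : ℂ))⁻¹ *
        replicateRow Unit (hermSplit p T).1.2 =
      toHermMatrix p ((hermSplit p T).2 - schurShift (hermSplit p T).1) := by
  rw [toHermMatrix_sub_schurShift]
  congr 1
  ext i j
  rw [inv_subsingleton]
  simp [mul_apply, vecMulVec_apply]
  ring

theorem det_toHermMatrix_succ {p : ℕ} (T : HermParam (p + 1)) (hx : (hermSplit p T).1.1 ≠ 0) :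
    (toHermMatrix (p + 1) T).det = ((hermSplit p T).1.1 : ℂ) *
      (toHermMatrix p ((hermSplit p T).2 - schurShift (hermSplit p T).1)).det := by
  have hA : IsUnit (diagonal fun _ : Unit => ((hermSplit p T).1.1 : ℂ)) := by
    rw [isUnit_iff_isUnit_det]
    simpa using hx
  let := hA.invertible
  rw [← det_submatrix_equiv_self (unitSumFinEquiv p), toHermMatrix_submatrix, det_fromBlocks₁₁,
    invOf_eq_nonsing_inv, schurComplement_eq]
  simp

theorem posDef_toHermMatrix_succ {p : ℕ} (T : HermParam (p + 1)) (hx : 0 < (hermSplit p T).1.1) :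
    (toHermMatrix (p + 1) T).PosDef ↔
      (toHermMatrix p ((hermSplit p T).2 - schurShift (hermSplit p T).1)).PosDef := by
  have hA : (diagonal fun _ : Unit => ((hermSplit p T).1.1 : ℂ)).PosDef :=
    PosDef.diagonal fun _ => by exact_mod_cast hx
  let := hA.isUnit.invertible
  have hiff : (toHermMatrix (p + 1) T).PosSemidef ↔
      (toHermMatrix p ((hermSplit p T).2 - schurShift (hermSplit p T).1)).PosSemidef := by
    rw [← posSemidef_submatrix_equiv (unitSumFinEquiv p), toHermMatrix_submatrix,
      PosDef.fromBlocks₁₁ _ _ hA, schurComplement_eq]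
  have hdet := det_toHermMatrix_succ T hx.ne'
  constructor
  · intro h
    refine (hiff.1 h.posSemidef).posDef_iff_det_ne_zero.2 fun h0 => h.det_pos.ne' ?_
    rw [hdet, h0, mul_zero]
  · intro h
    refine (hiff.2 h.posSemidef).posDef_iff_det_ne_zero.2 ?_
    rw [hdet]
    exact mul_ne_zero (Complex.ofReal_ne_zero.2 hx.ne') (ne_of_gt h.det_pos)

/-- The factor of the gamma integrand contributed by the first row of the matrix. -/
noncomputable def rowWeight (p : ℕ) (a : ℂ) (u : ℝ × (Fin p → ℂ)) : ℂ :=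
  Set.indicator (Set.Ioi 0) (fun x : ℝ => (x : ℂ) ^ (a - (p + 1)) * Real.exp (-x)) u.1 *
    ∏ i, ((Real.exp (-u.1⁻¹ * ‖u.2 i‖ ^ 2) : ℝ) : ℂ)

theorem expNegTrace_succ {p : ℕ} (T : HermParam (p + 1)) :
    expNegTrace (p + 1) T = (Real.exp (-(hermSplit p T).1.1) : ℂ) *
      (∏ i, ((Real.exp (-(hermSplit p T).1.1⁻¹ * ‖(hermSplit p T).1.2 i‖ ^ 2) : ℝ) : ℂ)) *
        expNegTrace p ((hermSplit p T).2 - schurShift (hermSplit p T).1) := by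
  rw [expNegTrace, expNegTrace]
  rw [← Complex.ofReal_prod, ← Real.exp_sum, ← Complex.ofReal_neg, ← Complex.ofReal_neg,
    ← Complex.ofReal_exp, ← Complex.ofReal_exp, ← Complex.ofReal_mul, ← Complex.ofReal_mul,
    ← Real.exp_add, ← Real.exp_add]
  congr 2
  have : ∀ i, ((hermSplit p T).2 - schurShift (hermSplit p T).1).1 i =
      T.1 i.succ - (hermSplit p T).1.1⁻¹ * ‖(hermSplit p T).1.2 i‖ ^ 2 := fun i => by
    rw [Prod.fst_sub, Pi.sub_apply, schurShift_fst, Complex.normSq_eq_norm_sq]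
    rfl
  simp only [this, Fin.sum_univ_succ, Finset.sum_sub_distrib, neg_mul, Finset.sum_neg_distrib]
  simp only [hermSplit]
  ring

theorem gammaIntegrand_succ {p : ℕ} (a : ℂ) (T : HermParam (p + 1)) :
    conePow (p + 1) a T * expNegTrace (p + 1) T =
      rowWeight p a (hermSplit p T).1 *
        (conePow p (a - 1) ((hermSplit p T).2 - schurShift (hermSplit p T).1) *
          expNegTrace p ((hermSplit p T).2 - schurShift (hermSplit p T).1)) := by
  by_cases hx : 0 < (hermSplit p T).1.1
  · rw [rowWeight, Set.indicator_of_mem (Set.mem_Ioi.2 hx), expNegTrace_succ]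
    by_cases hS : (toHermMatrix p ((hermSplit p T).2 - schurShift (hermSplit p T).1)).PosDef
    · rw [conePow_of_posDef _ hS, conePow_of_posDef _ ((posDef_toHermMatrix_succ T hx).2 hS),
        det_toHermMatrix_succ T hx.ne', Complex.re_ofReal_mul, Complex.ofReal_mul,
        Complex.mul_cpow_ofReal_nonneg hx.le (Complex.pos_iff.1 hS.det_pos).1.le]
      have : a - 1 - (p : ℂ) = a - (p + 1) := by ring
      rw [this, Nat.cast_add, Nat.cast_one]
      ring
    · rw [conePow_of_not_posDef _ hS, conePow_of_not_posDef]
      · ring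
      · rwa [posDef_toHermMatrix_succ T hx]
  · rw [rowWeight, Set.indicator_of_notMem (by simpa using hx), conePow_of_not_posDef]
    · ring
    · intro h
      have h0 := h.diag_pos (i := 0)
      rw [toHermMatrix_apply_self] at h0
      exact hx (by exact_mod_cast h0)

theorem measurable_schurShift (p : ℕ) :
    Measurable (schurShift : ℝ × (Fin p → ℂ) → HermParam p) := by
  refine (measurable_hermCoords p).comp
    (measurable_pi_lambda _ fun i => measurable_pi_lambda _ fun j => ?_)
  have h (l : Fin p) : Measurable fun u : ℝ × (Fin p → ℂ) => u.2 l :=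
    (measurable_pi_apply l).comp measurable_snd
  exact (Complex.measurable_ofReal.comp measurable_fst.inv).mul
    ((Complex.continuous_conj.measurable.comp (h i)).mul (h j))

theorem measurePreserving_sub_schurShift (p : ℕ) :
    MeasurePreserving (fun q : (ℝ × (Fin p → ℂ)) × HermParam p => (q.1, q.2 - schurShift q.1))
      (volume.prod volume) (volume.prod volume) := by
  refine (MeasurePreserving.id _).skew_product
    (g := fun (u : ℝ × (Fin p → ℂ)) (Y : HermParam p) => Y - schurShift u) ?_ ?_
  · exact measurable_snd.sub ((measurable_schurShift p).comp measurable_fst)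
  · exact Filter.Eventually.of_forall fun u => (measurePreserving_sub_right volume _).map_eq

theorem integral_prod_exp_neg_mul_norm_sq (p : ℕ) {x : ℝ} (hx : 0 < x) :
    ∫ z : Fin p → ℂ, ∏ i, Real.exp (-x⁻¹ * ‖z i‖ ^ 2) = (Real.pi * x) ^ p := by
  rw [integral_fintype_prod_volume_eq_pow (fun z : ℂ => Real.exp (-x⁻¹ * ‖z‖ ^ 2)),
    GaussianFourier.integral_rexp_neg_mul_sq_norm (inv_pos.2 hx), Complex.finrank_real_complex,
    Fintype.card_fin]
  norm_num

theorem integrable_prod_exp_neg_mul_norm_sq (p : ℕ) {x : ℝ} (hx : 0 < x) :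
    Integrable fun z : Fin p → ℂ => ∏ i, Real.exp (-x⁻¹ * ‖z i‖ ^ 2) := by
  by_contra h
  have := integral_prod_exp_neg_mul_norm_sq p hx
  rw [integral_undef h] at this
  exact (pow_pos (mul_pos Real.pi_pos hx) p).ne this

theorem measurable_rowWeight (p : ℕ) (a : ℂ) : Measurable (rowWeight p a) := by
  refine Measurable.mul ?_ ?_
  · refine Measurable.comp (g := Set.indicator (Set.Ioi 0)
      fun x : ℝ => (x : ℂ) ^ (a - (p + 1)) * Real.exp (-x)) ?_ measurable_fst
    refine Measurable.indicator ?_ measurableSet_Ioi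
    exact (Complex.measurable_ofReal.pow_const _).mul (by fun_prop)
  · refine Finset.measurable_prod _ fun i _ => ?_
    refine Complex.measurable_ofReal.comp (Real.measurable_exp.comp ?_)
    have h : Measurable fun u : ℝ × (Fin p → ℂ) => u.2 i :=
      (measurable_pi_apply i).comp measurable_snd
    exact measurable_fst.inv.neg.mul (h.norm.pow_const 2)

theorem rowWeight_of_pos {p : ℕ} (a : ℂ) {x : ℝ} (hx : 0 < x) (z : Fin p → ℂ) :
    rowWeight p a (x, z) = (x : ℂ) ^ (a - (p + 1)) * Real.exp (-x) *
      ((∏ i, Real.exp (-x⁻¹ * ‖z i‖ ^ 2) : ℝ) : ℂ) := by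
  rw [rowWeight, Set.indicator_of_mem (Set.mem_Ioi.2 hx), Complex.ofReal_prod]

theorem rowWeight_of_nonpos {p : ℕ} (a : ℂ) {x : ℝ} (hx : ¬ 0 < x) (z : Fin p → ℂ) :
    rowWeight p a (x, z) = 0 := by
  rw [rowWeight, Set.indicator_of_notMem (by simpa using hx), zero_mul]

theorem integrable_rowWeight {p : ℕ} {a : ℂ} (ha : 0 < a.re) :
    Integrable (rowWeight p a) (volume.prod volume) := by
  rw [integrable_prod_iff (measurable_rowWeight p a).aestronglyMeasurable]
  refine ⟨Filter.Eventually.of_forall fun x => ?_, ?_⟩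
  · by_cases hx : 0 < x
    · simp only [rowWeight_of_pos a hx]
      exact (integrable_prod_exp_neg_mul_norm_sq p hx).ofReal.const_mul _
    · simp only [rowWeight_of_nonpos a hx]
      exact integrable_zero _ _ _
  · have h := ((Real.GammaIntegral_convergent ha).integrable_indicator
      measurableSet_Ioi).const_mul (Real.pi ^ p)
    refine h.congr (Filter.Eventually.of_forall fun x => ?_)
    by_cases hx : 0 < x
    · have hpos (z : Fin p → ℂ) : 0 ≤ ∏ i, Real.exp (-x⁻¹ * ‖z i‖ ^ 2) :=
        Finset.prod_nonneg fun _ _ => (Real.exp_pos _).le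
      simp only [rowWeight_of_pos a hx, norm_mul, Complex.norm_cpow_eq_rpow_re_of_pos hx,
        Complex.norm_real, Real.norm_of_nonneg (Real.exp_pos _).le, Real.norm_of_nonneg (hpos _)]
      rw [integral_const_mul, integral_prod_exp_neg_mul_norm_sq p hx,
        Set.indicator_of_mem (Set.mem_Ioi.2 hx), mul_pow]
      have : x ^ (a.re - 1) = x ^ (a - (p + 1)).re * x ^ p := by
        rw [← Real.rpow_natCast x p, ← Real.rpow_add hx]
        congr 1
        simp
        ring
      rw [this]
      ring
    · have hx' : x ∉ Set.Ioi (0 : ℝ) := hx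
      simp [rowWeight_of_nonpos a hx, Set.indicator_of_notMem hx']

theorem integral_rowWeight {p : ℕ} {a : ℂ} (ha : 0 < a.re) :
    ∫ u, rowWeight p a u ∂(volume.prod volume) = Real.pi ^ p * Complex.Gamma a := by
  rw [integral_prod _ (integrable_rowWeight ha), Complex.Gamma_eq_integral ha,
    Complex.GammaIntegral, ← integral_indicator measurableSet_Ioi, ← integral_const_mul]
  refine integral_congr_ae (Filter.Eventually.of_forall fun x => ?_)
  by_cases hx : 0 < x
  · have hx' : (x : ℂ) ≠ 0 := Complex.ofReal_ne_zero.2 hx.ne'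
    simp only [rowWeight_of_pos a hx]
    rw [integral_const_mul, integral_complex_ofReal, integral_prod_exp_neg_mul_norm_sq p hx,
      Set.indicator_of_mem (Set.mem_Ioi.2 hx)]
    have : (x : ℂ) ^ (a - 1) = (x : ℂ) ^ (a - (p + 1)) * (x : ℂ) ^ p := by
      rw [← Complex.cpow_natCast, ← Complex.cpow_add _ _ hx']
      congr 1
      ring
    rw [this]
    push_cast
    ring
  · have hx' : x ∉ Set.Ioi (0 : ℝ) := hx
    simp [rowWeight_of_nonpos a hx, Set.indicator_of_notMem hx']

theorem cGammaP_succ (p : ℕ) (a : ℂ) :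
    cGammaP (p + 1) a = Real.pi ^ p * Complex.Gamma a * cGammaP p (a - 1) := by
  have h : (p + 1) * (p + 1 - 1) / 2 = p + p * (p - 1) / 2 := by
    rw [Nat.triangle_succ, add_comm]
  rw [cGammaP, cGammaP, h, pow_add, Fin.prod_univ_succ]
  have : ∀ j : Fin p, a - ((j.succ : Fin (p + 1)) : ℕ) = a - 1 - (j : ℕ) := fun j => by
    rw [Fin.val_succ]
    push_cast
    ring
  simp only [this, Fin.val_zero, Nat.cast_zero, sub_zero]
  ring

/-- The matrix-variate gamma integral over the cone of positive definite Hermitian matrices. -/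
theorem conePow_gamma_integral (p : ℕ) (a : ℂ)
    (ha : (p - 1 : ℝ) < a.re) :
    Integrable (fun T : HermParam p => conePow p a T * expNegTrace p T) ∧
      ∫ T : HermParam p, conePow p a T * expNegTrace p T = cGammaP p a := by
  induction p generalizing a with
  | zero =>
    have hconst : ∀ T : HermParam 0, conePow 0 a T * expNegTrace 0 T = 1 := fun T => by
      rw [conePow_of_posDef]
      · simp [expNegTrace]
      · refine (PosSemidef.posDef_iff_det_ne_zero ?_).2 (by simp)
        rw [Subsingleton.elim (toHermMatrix 0 T) 0]
        exact PosSemidef.zero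
    have hvol : (volume : Measure (HermParam 0)) Set.univ = 1 := by
      rw [Measure.volume_eq_prod, ← Set.univ_prod_univ, Measure.prod_prod]
      simp [volume_pi]
    have : IsProbabilityMeasure (volume : Measure (HermParam 0)) := ⟨hvol⟩
    simp only [hconst]
    exact ⟨integrable_const _, by simp [cGammaP]⟩
  | succ p ih =>
    push_cast at ha
    have hp : (0 : ℝ) ≤ p := p.cast_nonneg
    obtain ⟨ih1, ih2⟩ := ih (a - 1) (by rw [Complex.sub_re, Complex.one_re]; linarith)
    have ha0 : 0 < a.re := by linarith
    have hmp : MeasurePreserving (fun T : HermParam (p + 1) => ((hermSplit p T).1,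
        (hermSplit p T).2 - schurShift (hermSplit p T).1)) volume
        ((volume.prod volume).prod volume) :=
      (measurePreserving_sub_schurShift p).comp (measurePreserving_hermSplit p)
    have hint := (integrable_rowWeight (p := p) ha0).mul_prod ih1
    simp only [gammaIntegrand_succ]
    refine ⟨hmp.integrable_comp_of_integrable hint, ?_⟩
    rw [cGammaP_succ, ← integral_rowWeight ha0, ← ih2, ← integral_prod_mul]
    conv_rhs => rw [← hmp.map_eq]
    rw [integral_map hmp.aemeasurable]
    rw [hmp.map_eq]
    exact hint.aestronglyMeasurable

theorem cGammaP_ne_zero {p : ℕ} {a : ℂ} (ha : (p - 1 : ℝ) < a.re) : cGammaP p a ≠ 0 := by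
  refine mul_ne_zero (pow_ne_zero _ (Complex.ofReal_ne_zero.2 Real.pi_ne_zero))
    (Finset.prod_ne_zero_iff.2 fun j _ => Complex.Gamma_ne_zero_of_re_pos ?_)
  have : ((j : ℕ) : ℝ) + 1 ≤ p := by exact_mod_cast j.2
  simp only [Complex.sub_re, Complex.natCast_re]
  linarith

theorem measurePreserving_sub_sum (p k : ℕ) :
    MeasurePreserving
      (fun q : (Fin k → HermParam p) × HermParam p => (q.1, q.2 - ∑ j, q.1 j))
      (volume.prod volume) (volume.prod volume) := by
  refine (MeasurePreserving.id _).skew_product 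
    (g := fun (X : Fin k → HermParam p) (S : HermParam p) => S - ∑ j, X j) ?_ ?_
  · exact Continuous.measurable (by fun_prop)
  · exact Filter.Eventually.of_forall fun X => (measurePreserving_sub_right volume _).map_eq

theorem dirichletIntegral_one {p k : ℕ} (a : Fin k → ℂ) (b : ℂ)
    (ha : ∀ j, (p - 1 : ℝ) < (a j).re) (hb : (p - 1 : ℝ) < b.re)
    (hab : (p - 1 : ℝ) < ((∑ j, a j) + b).re) :
    dirichletIntegral p a b (hermCoords p 1) =
      (∏ j, cGammaP p (a j)) * cGammaP p b / cGammaP p ((∑ j, a j) + b) := by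
  set f : (Fin k → HermParam p) × HermParam p → ℂ := fun q =>
    (∏ j, conePow p (a j) (q.1 j) * expNegTrace p (q.1 j)) *
      (conePow p b q.2 * expNegTrace p q.2) with hf
  have hX : Integrable (fun X : Fin k → HermParam p =>
      ∏ j, conePow p (a j) (X j) * expNegTrace p (X j)) :=
    Integrable.fintype_prod fun j => (conePow_gamma_integral p (a j) (ha j)).1
  have hfi : Integrable f (volume.prod volume) :=
    hX.mul_prod (conePow_gamma_integral p b hb).1
  have hfv : ∫ q, f q ∂(volume.prod volume) = (∏ j, cGammaP p (a j)) * cGammaP p b := by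
    rw [hf, integral_prod_mul (fun X : Fin k → HermParam p =>
      ∏ j, conePow p (a j) (X j) * expNegTrace p (X j))
      (fun Y => conePow p b Y * expNegTrace p Y),
      (conePow_gamma_integral p b hb).2]
    congr 1
    rw [integral_fintype_prod_volume_eq_prod (fun j (T : HermParam p) =>
      conePow p (a j) T * expNegTrace p T)]
    exact Finset.prod_congr rfl fun j _ =>
      (conePow_gamma_integral p (a j) (ha j)).2
  have hθ := measurePreserving_sub_sum p k
  have hcomp : ∀ (X : Fin k → HermParam p) (S : HermParam p), f (X, S - ∑ j, X j) =
      expNegTrace p S *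
        ((∏ j, conePow p (a j) (X j)) * conePow p b (S - ∑ j, X j)) := fun X S => by
    have hS : expNegTrace p S = (∏ j, expNegTrace p (X j)) * expNegTrace p (S - ∑ j, X j) := by
      rw [← expNegTrace_sum, ← expNegTrace_add, add_sub_cancel]
    rw [hS, hf]
    simp only [Finset.prod_mul_distrib]
    ring
  have hgi : Integrable (fun q : (Fin k → HermParam p) × HermParam p =>
      f (q.1, q.2 - ∑ j, q.1 j)) (volume.prod volume) := hθ.integrable_comp_of_integrable hfi
  have hgv : ∫ q : (Fin k → HermParam p) × HermParam p, f (q.1, q.2 - ∑ j, q.1 j)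
      ∂(volume.prod volume) = (∏ j, cGammaP p (a j)) * cGammaP p b := by
    rw [← hfv]
    conv_rhs => rw [← hθ.map_eq]
    rw [integral_map hθ.aemeasurable]
    rw [hθ.map_eq]
    exact hfi.aestronglyMeasurable
  rw [integral_prod_symm _ hgi] at hgv
  simp only [hcomp, integral_const_mul] at hgv
  have hS : ∀ S : HermParam p, expNegTrace p S * (∫ X : Fin k → HermParam p,
      (∏ j, conePow p (a j) (X j)) * conePow p b (S - ∑ j, X j)) =
      (conePow p ((∑ j, a j) + b) S * expNegTrace p S) *
        dirichletIntegral p a b (hermCoords p 1) := fun S => by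
    have := dirichletIntegral_eq a b S
    rw [dirichletIntegral] at this
    rw [this]
    ring
  simp only [hS] at hgv
  rw [integral_mul_const, (conePow_gamma_integral p _ hab).2] at hgv
  rw [← hgv, mul_div_cancel_left₀ _ (cGammaP_ne_zero hab)]

theorem measurable_toHermMatrix (p : ℕ) : Measurable (toHermMatrix p) := by
  refine measurable_pi_lambda _ fun i => measurable_pi_lambda _ fun j => ?_
  exact ((continuous_toHermMatrix p).matrix_elem i j).measurable

theorem measurableSet_range_toHermMatrix (p : ℕ) :
    MeasurableSet (Set.range (toHermMatrix p)) := by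
  have : Set.range (toHermMatrix p) = {M | toHermMatrix p (hermCoords p M) = M} := by
    ext M
    constructor
    · rintro ⟨T, rfl⟩
      exact congrArg _ (hermCoords_toHermMatrix T)
    · exact fun h => ⟨_, h⟩
  rw [this]
  exact measurableSet_eq_fun (β := Fin p → Fin p → ℂ)
    ((measurable_toHermMatrix p).comp (measurable_hermCoords p)) measurable_id

theorem measurableEmbedding_toHermMatrix (p : ℕ) : MeasurableEmbedding (toHermMatrix p) :=
  MeasurableEmbedding.of_measurable_inverse (measurable_toHermMatrix p)
    (measurableSet_range_toHermMatrix p) (measurable_hermCoords p) hermCoords_toHermMatrix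

theorem pi_hermLebesgue (p k : ℕ) :
    (Measure.pi fun _ : Fin k => hermLebesgue p) =
      Measure.map (fun (X : Fin k → HermParam p) j => toHermMatrix p (X j)) volume := by
  have hs : SigmaFinite (Measure.map (toHermMatrix p) volume) :=
    (measurableEmbedding_toHermMatrix p).sigmaFinite_map
  exact (Measure.pi_map_pi (hμ := fun _ => hs)
    (μ := fun _ : Fin k => (volume : Measure (HermParam p)))
    (f := fun _ => toHermMatrix p)
    fun _ => (measurableEmbedding_toHermMatrix p).measurable.aemeasurable).symm

theorem measurableEmbedding_pi_toHermMatrix (p k : ℕ) :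
    MeasurableEmbedding fun (X : Fin k → HermParam p) j => toHermMatrix p (X j) := by
  refine MeasurableEmbedding.of_measurable_inverse
    (g := fun (M : Fin k → Matrix (Fin p) (Fin p) ℂ) j => hermCoords p (M j)) ?_ ?_ ?_ ?_
  · exact measurable_pi_lambda _ fun j =>
      (measurable_toHermMatrix p).comp (measurable_pi_apply j)
  · have : (Set.range fun (X : Fin k → HermParam p) j => toHermMatrix p (X j)) =
        Set.pi Set.univ fun _ => Set.range (toHermMatrix p) := by
      ext M
      simp only [Set.mem_range, Set.mem_univ_pi]
      constructor
      · rintro ⟨X, rfl⟩ j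
        exact ⟨X j, rfl⟩
      · intro h
        choose X hX using h
        exact ⟨X, funext hX⟩
    rw [this]
    exact MeasurableSet.univ_pi fun _ => measurableSet_range_toHermMatrix p
  · exact measurable_pi_lambda _ fun j =>
      (measurable_hermCoords p).comp (measurable_pi_apply j)
  · exact fun X => funext fun j => hermCoords_toHermMatrix (X j)

theorem toHermMatrix_hermCoords_one_sub_sum {p k : ℕ} (X : Fin k → HermParam p) :
    toHermMatrix p (hermCoords p 1 - ∑ j, X j) = 1 - ∑ j, toHermMatrix p (X j) := by
  simp only [← toHermLin_apply, map_sub, map_sum]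
  rw [toHermLin_apply, toHermMatrix_hermCoords isHermitian_one]

theorem det_re_cpow_mul {p : ℕ} {M : Matrix (Fin p) (Fin p) ℂ} (hM : M.PosDef) (a c : ℂ) :
    (M.det.re : ℂ) ^ c * (M.det.re : ℂ) ^ (a - p) = (M.det.re : ℂ) ^ (a + c - p) := by
  rw [← Complex.cpow_add _ _ (Complex.ofReal_ne_zero.2 (Complex.pos_iff.1 hM.det_pos).1.ne')]
  congr 1
  ring

theorem stmt9 (p k : ℕ) (hp : 1 ≤ p) (hk : 1 ≤ k)
    (α : Fin (k + 1) → ℂ) (γ : Fin k → ℂ)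
    (hα : ∀ j, (p - 1 : ℝ) < (α j).re)
    (hαγ : ∀ j : Fin k, (p - 1 : ℝ) < (α j.castSucc + γ j).re) :
    ∫ X in {X : Fin k → Matrix (Fin p) (Fin p) ℂ |
        (∀ j, (X j).PosDef) ∧ (1 - ∑ j, X j).PosDef},
      ((∏ j : Fin k, ((X j).det.re : ℂ) ^ (γ j)) *
        ((cGammaP p (∑ j, α j) / ∏ j : Fin (k + 1), cGammaP p (α j)) *
          (∏ j : Fin k, ((X j).det.re : ℂ) ^ (α j.castSucc - p)) *
          (((1 - ∑ j, X j).det.re : ℂ) ^ (α (Fin.last k) - p))))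
      ∂(Measure.pi fun _ : Fin k => hermLebesgue p)
    = (∏ j : Fin k, cGammaP p (α j.castSucc + γ j) / cGammaP p (α j.castSucc)) *
        cGammaP p (∑ j, α j) /
          cGammaP p ((∑ j : Fin k, (α j.castSucc + γ j)) + α (Fin.last k)) := by
  set D : ℂ := cGammaP p (∑ j, α j) / ∏ j : Fin (k + 1), cGammaP p (α j) with hD
  have hemb := measurableEmbedding_pi_toHermMatrix p k
  rw [pi_hermLebesgue, hemb.setIntegral_map]
  have hset : MeasurableSet ((fun (X : Fin k → HermParam p) j => toHermMatrix p (X j)) ⁻¹'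
      {X | (∀ j, (X j).PosDef) ∧ (1 - ∑ j, X j).PosDef}) := by
    have hmeas := measurableSet_posDef_toHermMatrix p
    have hsub : Measurable fun X : Fin k → HermParam p => hermCoords p 1 - ∑ j, X j :=
      Continuous.measurable (by fun_prop)
    have := (MeasurableSet.iInter fun j : Fin k =>
      hmeas.preimage (measurable_pi_apply (X := fun _ => HermParam p) j)).inter
        (hmeas.preimage hsub)
    convert this using 1
    ext X
    simp only [Set.mem_preimage, Set.mem_ofPred_eq, Set.mem_inter_iff, Set.mem_iInter,
      toHermMatrix_hermCoords_one_sub_sum]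
  rw [← integral_indicator hset]
  have hint : ∀ X : Fin k → HermParam p, Set.indicator
      ((fun (X : Fin k → HermParam p) j => toHermMatrix p (X j)) ⁻¹'
        {X | (∀ j, (X j).PosDef) ∧ (1 - ∑ j, X j).PosDef})
      (fun X => (∏ j : Fin k, ((toHermMatrix p (X j)).det.re : ℂ) ^ (γ j)) *
        (D * (∏ j : Fin k, ((toHermMatrix p (X j)).det.re : ℂ) ^ (α j.castSucc - p)) *
          (((1 - ∑ j, toHermMatrix p (X j)).det.re : ℂ) ^ (α (Fin.last k) - p)))) X =
      D * ((∏ j, conePow p (α j.castSucc + γ j) (X j)) *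
        conePow p (α (Fin.last k)) (hermCoords p 1 - ∑ j, X j)) := fun X => by
    by_cases h1 : ∀ j, (toHermMatrix p (X j)).PosDef
    · by_cases h2 : (toHermMatrix p (hermCoords p 1 - ∑ j, X j)).PosDef
      · rw [Set.indicator_of_mem, conePow_of_posDef _ h2, toHermMatrix_hermCoords_one_sub_sum]
        · simp only [conePow_of_posDef _ (h1 _), ← det_re_cpow_mul (h1 _),
            Finset.prod_mul_distrib]
          ring
        · exact ⟨h1, toHermMatrix_hermCoords_one_sub_sum X ▸ h2⟩
      · rw [Set.indicator_of_notMem, conePow_of_not_posDef _ h2, mul_zero, mul_zero]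
        exact fun h => h2 (toHermMatrix_hermCoords_one_sub_sum X ▸ h.2)
    · rw [Set.indicator_of_notMem fun h => h1 h.1]
      push Not at h1
      obtain ⟨j, hj⟩ := h1
      rw [Finset.prod_eq_zero (Finset.mem_univ j) (conePow_of_not_posDef _ hj), zero_mul, mul_zero]
  rw [integral_congr_ae (Filter.Eventually.of_forall hint), integral_const_mul]
  have hab : (p - 1 : ℝ) < ((∑ j : Fin k, (α j.castSucc + γ j)) + α (Fin.last k)).re := by
    have hp' : (1 : ℝ) ≤ p := by exact_mod_cast hp
    have : 0 ≤ (∑ j : Fin k, (α j.castSucc + γ j)).re := by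
      rw [Complex.re_sum]
      exact Finset.sum_nonneg fun j _ => by linarith [hαγ j]
    rw [Complex.add_re]
    linarith [hα (Fin.last k)]
  have hmain := dirichletIntegral_one (fun j : Fin k => α j.castSucc + γ j) (α (Fin.last k))
    hαγ (hα _) hab
  rw [dirichletIntegral] at hmain
  rw [hmain, hD, Fin.prod_univ_castSucc, Finset.prod_div_distrib]
  have h1 : cGammaP p (α (Fin.last k)) ≠ 0 := cGammaP_ne_zero (hα _)
  field_simp
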